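/- Let a and b be positive integers with a ∣ b, let S be a gcd-closed set of distinct positive integers, and let x, y, z ∈ S with G_S(x) = {y}. Then the integer x^a − y^a divides each of the integers gcd(x, z)^b − gcd(y, z)^b and lcm(x, z)^b − lcm(y, z)^b; moreover, for any r ∈ S with r ∣ x, the integer r^a·(y^a − x^a) divides y^a·lcm(z, x)^b − x^a·lcm(z, y)^b. -/

import Mathlib

open Finset

def gcdClosed (S : Finset ℕ) : Prop := ∀ x ∈ S, ∀ y ∈ S, Nat.gcd x y ∈ S

/-- The set of greatest-type divisors of `x` in `S`. -/
def GTD (S : Finset ℕ) (x : ℕ) : Finset ℕ :=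
  S.filter fun d => d < x ∧ d ∣ x ∧ ∀ y ∈ S, d ∣ y → y ∣ x → y = d ∨ y = x

/-- The element `x` satisfies condition 𝒢 with respect to `S`. -/
def condGAt (S : Finset ℕ) (x : ℕ) : Prop :=
  ∀ y₁ ∈ GTD S x, ∀ y₂ ∈ GTD S x, y₁ ≠ y₂ →
    Nat.lcm y₁ y₂ = x ∧ Nat.gcd y₁ y₂ ∈ GTD S y₁ ∧ Nat.gcd y₁ y₂ ∈ GTD S y₂

/-- The set `S` satisfies condition 𝒢. -/
def condG (S : Finset ℕ) : Prop := ∀ x ∈ S, condGAt S x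

/-- `c_{ij}`: the sum of `μ(d)` over positive integers `d` with `d·x_i ∣ x_j` and
`d·x_i ∤ x_t` for every `x_t ∈ S` with `x_t < x_j`. -/
def cMat {n : ℕ} (x : Fin n → ℕ) (i j : Fin n) : ℤ :=
  ∑ d ∈ (x j).divisors.filter
      (fun d => d * x i ∣ x j ∧ ∀ t : Fin n, x t < x j → ¬ d * x i ∣ x t),
    ArithmeticFunction.moebius d

/-- `α_{ξ_a}(x_k)`: the sum of `(ξ_a * μ)(d)` over divisors `d` of `x_k` with
`d ∤ x_t` for every `x_t ∈ S` with `x_t < x_k`. -/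
def alphaXi {n : ℕ} (a : ℕ) (x : Fin n → ℕ) (k : Fin n) : ℤ :=
  ∑ d ∈ (x k).divisors.filter (fun d => ∀ t : Fin n, x t < x k → ¬ d ∣ x t),
    ∑ e ∈ d.divisors, (e : ℤ) ^ a * ArithmeticFunction.moebius (d / e)

/-- `α_{1/ξ_a}(x_k)`: the sum of `((1/ξ_a) * μ)(d)` over divisors `d` of `x_k` with
`d ∤ x_t` for every `x_t ∈ S` with `x_t < x_k`. -/
def alphaInvXi {n : ℕ} (a : ℕ) (x : Fin n → ℕ) (k : Fin n) : ℚ :=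
  ∑ d ∈ (x k).divisors.filter (fun d => ∀ t : Fin n, x t < x k → ¬ d ∣ x t),
    ∑ e ∈ d.divisors, ((e : ℚ) ^ a)⁻¹ * ((ArithmeticFunction.moebius (d / e) : ℤ) : ℚ)

/-- A proper divisor of `x` in `S` divides some greatest-type divisor of `x`. -/
theorem exists_mem_GTD_of_dvd {S : Finset ℕ} {x d : ℕ} (hx : 0 < x) (hd : d ∈ S)
    (hdx : d ∣ x) (hne : d ≠ x) : ∃ m ∈ GTD S x, d ∣ m := by
  have hlt : d < x := lt_of_le_of_ne (Nat.le_of_dvd hx hdx) hne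
  obtain ⟨m, hm, hmax⟩ := (S.filter fun e => d ∣ e ∧ e ∣ x ∧ e < x).exists_max_image id
    ⟨d, by simp [hd, hdx, hlt]⟩
  simp only [Finset.mem_filter, id] at hm hmax
  obtain ⟨hmS, hdm, hmx, hmlt⟩ := hm
  refine ⟨m, Finset.mem_filter.2 ⟨hmS, hmlt, hmx, fun e he hme hex => ?_⟩, hdm⟩
  rcases (Nat.le_of_dvd hx hex).eq_or_lt with h | h
  · exact Or.inr h
  · have hepos : 0 < e := Nat.pos_of_dvd_of_pos hex hx
    exact Or.inl (le_antisymm (hmax e ⟨he, hdm.trans hme, hex, h⟩) (Nat.le_of_dvd hepos hme))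

theorem pow_sub_pow_dvd_of_dvd {R : Type*} [CommRing R] (u v : R) {a b : ℕ} (hab : a ∣ b) :
    u ^ a - v ^ a ∣ u ^ b - v ^ b := by
  obtain ⟨c, rfl⟩ := hab
  simpa only [pow_mul] using sub_dvd_pow_sub_pow (u ^ a) (v ^ a) c

/-- If `x` has the single greatest-type divisor `y`, then either `x ∣ z`, or `x` and `y` have the
same gcd with `z`. -/
theorem dvd_or_gcd_eq_gcd_of_GTD_eq_singleton {S : Finset ℕ} {x y z : ℕ} (hgcd : gcdClosed S)
    (hx0 : 0 < x) (hx : x ∈ S) (hz : z ∈ S) (hGTD : GTD S x = {y}) :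
    x ∣ z ∨ Nat.gcd x z = Nat.gcd y z := by
  by_cases hg : Nat.gcd x z = x
  · exact Or.inl (Nat.gcd_eq_left_iff_dvd.1 hg)
  · right
    obtain ⟨m, hm, hdm⟩ := exists_mem_GTD_of_dvd hx0 (hgcd x hx z hz) (Nat.gcd_dvd_left x z) hg
    rw [hGTD, Finset.mem_singleton] at hm
    subst hm
    have hmx : m ∣ x := (Finset.mem_filter.1 (hGTD ▸ Finset.mem_singleton_self m)).2.2.1
    exact Nat.dvd_antisymm (Nat.dvd_gcd hdm (Nat.gcd_dvd_right x z))
      (Nat.gcd_dvd_gcd_of_dvd_left z hmx)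

theorem single_gtd_divisibility
    (a b : ℕ) (ha : 0 < a) (hb : 0 < b) (hab : a ∣ b)
    (S : Finset ℕ) (hpos : ∀ u ∈ S, 0 < u) (hgcd : gcdClosed S)
    (x y z : ℕ) (hx : x ∈ S) (hy : y ∈ S) (hz : z ∈ S)
    (hGTD : GTD S x = {y}) :
    ((x : ℤ) ^ a - (y : ℤ) ^ a) ∣ ((Nat.gcd x z : ℤ) ^ b - (Nat.gcd y z : ℤ) ^ b) ∧
    ((x : ℤ) ^ a - (y : ℤ) ^ a) ∣ ((Nat.lcm x z : ℤ) ^ b - (Nat.lcm y z : ℤ) ^ b) ∧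
    ∀ r ∈ S, r ∣ x →
      ((r : ℤ) ^ a * ((y : ℤ) ^ a - (x : ℤ) ^ a)) ∣
        ((y : ℤ) ^ a * (Nat.lcm z x : ℤ) ^ b - (x : ℤ) ^ a * (Nat.lcm z y : ℤ) ^ b) := by
  have hx0 := hpos x hx
  have hyx : y ∣ x := (Finset.mem_filter.1 (hGTD ▸ Finset.mem_singleton_self y)).2.2.1
  have hle : a ≤ b := Nat.le_of_dvd hb hab
  rcases dvd_or_gcd_eq_gcd_of_GTD_eq_singleton hgcd hx0 hx hz hGTD with hxz | hg
  · rw [Nat.gcd_eq_left hxz, Nat.gcd_eq_left (hyx.trans hxz), Nat.lcm_eq_right hxz,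
      Nat.lcm_eq_right (hyx.trans hxz), Nat.lcm_eq_left hxz, Nat.lcm_eq_left (hyx.trans hxz)]
    refine ⟨pow_sub_pow_dvd_of_dvd _ _ hab, by simp, fun r _ hr => ?_⟩
    have hrz : (r : ℤ) ^ a ∣ (z : ℤ) ^ b :=
      (pow_dvd_pow_of_dvd (Int.natCast_dvd_natCast.2 (hr.trans hxz)) a).trans (pow_dvd_pow _ hle)
    rw [← sub_mul, mul_comm]
    exact mul_dvd_mul_left _ hrz
  · obtain ⟨w, hw⟩ : Nat.gcd x z ∣ z := Nat.gcd_dvd_right x z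
    have hgpos : 0 < Nat.gcd x z := Nat.gcd_pos_of_pos_left z hx0
    have lcm_eq : ∀ u, Nat.gcd u z = Nat.gcd x z → Nat.lcm u z = u * w := fun u hu => by
      refine Nat.eq_of_mul_eq_mul_left hgpos ?_
      calc Nat.gcd x z * Nat.lcm u z = u * z := by rw [← hu, Nat.gcd_mul_lcm]
        _ = u * (Nat.gcd x z * w) := congrArg (u * ·) hw
        _ = Nat.gcd x z * (u * w) := by ring
    rw [Nat.lcm_comm z x, Nat.lcm_comm z y, lcm_eq x rfl, lcm_eq y hg.symm, hg]
    push_cast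
    refine ⟨by simp, ?_, fun r _ hr => ?_⟩
    · rw [mul_pow, mul_pow, ← sub_mul]
      exact (pow_sub_pow_dvd_of_dvd _ _ hab).mul_right _
    · obtain ⟨c, rfl⟩ := Nat.exists_eq_add_of_le hle
      have hac : a ∣ c := (Nat.dvd_add_right dvd_rfl).1 hab
      have hrx : (r : ℤ) ^ a ∣ (x : ℤ) ^ a :=
        pow_dvd_pow_of_dvd (Int.natCast_dvd_natCast.2 hr) a
      have hsub : (y : ℤ) ^ a - (x : ℤ) ^ a ∣ (x : ℤ) ^ c - (y : ℤ) ^ c :=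
        (dvd_sub_comm).1 (pow_sub_pow_dvd_of_dvd _ _ hac)
      calc _ ∣ _ := (mul_dvd_mul hrx hsub).mul_right ((y : ℤ) ^ a * (w : ℤ) ^ (a + c))
        _ = _ := by ring
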